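/- Every play of a Γ-bounded evaluation game G = (M, w₀, φ₀, Γ) ends after a finite number of rounds: there is no infinite sequence of positions p₀, p₁, p₂, … such that p₀ is the initial position of G and each p_{n+1} is a position reachable from p_n in one round of G according to the rules of the game. -/

import Mathlib

/-- Formulae of the modal μ-calculus, with negation only on proposition symbols:
`φ ::= p | ¬p | X | φ∨φ | φ∧φ | ◇φ | □φ | μX φ | νX φ`. -/
inductive Formula (Φ Λ : Type) : Type
  | atom  : Φ → Formula Φ Λ
  | natom : Φ → Formula Φ Λ
  | label : Λ → Formula Φ Λ
  | or    : Formula Φ Λ → Formula Φ Λ → Formula Φ Λ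
  | and   : Formula Φ Λ → Formula Φ Λ → Formula Φ Λ
  | dia   : Formula Φ Λ → Formula Φ Λ
  | box   : Formula Φ Λ → Formula Φ Λ
  | mu    : Λ → Formula Φ Λ → Formula Φ Λ
  | nu    : Λ → Formula Φ Λ → Formula Φ Λ

/-- A Kripke model `M = (W,R,V)` over the (nonempty) set `W` of worlds. -/
structure Kripke (Φ W : Type) where
  R : W → W → Prop
  V : Φ → Set W

variable {Φ Λ W : Type}
/-- The set of label symbols occurring free in a formula. -/
def freeLabels : Formula Φ Λ → Set Λ
  | .atom _ => ∅
  | .natom _ => ∅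
  | .label X => {X}
  | .or φ ψ => freeLabels φ ∪ freeLabels ψ
  | .and φ ψ => freeLabels φ ∪ freeLabels ψ
  | .dia φ => freeLabels φ
  | .box φ => freeLabels φ
  | .mu X φ => freeLabels φ \ {X}
  | .nu X φ => freeLabels φ \ {X}

/-- A sentence is a formula with no free label symbols. -/
def IsSentence (φ : Formula Φ Λ) : Prop := freeLabels φ = ∅

/-- The list of label symbols bound by the μ- and ν-operator occurrences of a formula
(with multiplicity). -/
def binderList : Formula Φ Λ → List Λ
  | .atom _ => []
  | .natom _ => []
  | .label _ => []
  | .or φ ψ => binderList φ ++ binderList ψ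
  | .and φ ψ => binderList φ ++ binderList ψ
  | .dia φ => binderList φ
  | .box φ => binderList φ
  | .mu X φ => X :: binderList φ
  | .nu X φ => X :: binderList φ

/-- A formula is in normal form if each label symbol occurs at most once bound by a
μ- or ν-operator in it. -/
def NormalForm (φ : Formula Φ Λ) : Prop := (binderList φ).Nodup
open scoped Classical

/-- The two players of the evaluation game. -/
inductive Player : Type
  | eloise
  | abelard
deriving DecidableEq

/-- A position `(w, φ, c)` of a Γ-bounded evaluation game for a sentence `φ₀`: a world `w`,
an occurrence of a subformula of `φ₀` (represented by its address `addr` in the syntax tree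
of `φ₀`), and a clock mapping `c` assigning ordinals to (addresses of) subformula
occurrences of `φ₀`. -/
structure GPos (W : Type) where
  world : W
  addr : List ℕ
  clock : List ℕ → Ordinal

/-- The subformula occurrence of `φ` at address `o` in its syntax tree
(`0` = left/unique child, `1` = right child), if any. -/
def nodeAt : Formula Φ Λ → List ℕ → Option (Formula Φ Λ)
  | φ, [] => some φ
  | .or φ _, 0 :: t => nodeAt φ t
  | .or _ ψ, 1 :: t => nodeAt ψ t
  | .and φ _, 0 :: t => nodeAt φ t
  | .and _ ψ, 1 :: t => nodeAt ψ t
  | .dia φ, 0 :: t => nodeAt φ t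
  | .box φ, 0 :: t => nodeAt φ t
  | .mu _ φ, 0 :: t => nodeAt φ t
  | .nu _ φ, 0 :: t => nodeAt φ t
  | _, _ => none

/-- Whether the occurrence at address `o` in `φ₀` is a μν-subformula occurrence. -/
def muNuAt (φ₀ : Formula Φ Λ) (o : List ℕ) : Bool :=
  match nodeAt φ₀ o with
  | some (.mu _ _) => true
  | some (.nu _ _) => true
  | _ => false

/-- Whether the occurrence at address `o` in `φ₀` is of the form `μX ψ` or `νX ψ`. -/
def bindsAt [DecidableEq Λ] (φ₀ : Formula Φ Λ) (X : Λ) (o : List ℕ) : Bool :=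
  match nodeAt φ₀ o with
  | some (.mu Y _) => decide (Y = X)
  | some (.nu Y _) => decide (Y = X)
  | _ => false

/-- The (address of the) reference formula `rf(X)` of an occurrence of the label `X`
at address `o` in `φ₀`: the innermost (longest) binder `μX ψ` / `νX ψ` on the branch
from the root to `o`. -/
def refOcc [DecidableEq Λ] (φ₀ : Formula Φ Λ) (X : Λ) (o : List ℕ) : Option (List ℕ) :=
  (o.inits.filter (fun o' => bindsAt φ₀ X o')).getLast?

/-- The player (if any) to move at a position: Eloise resolves `∨`, `◇`, `μ` and labels
bound by `μ`; Abelard resolves `∧`, `□`, `ν` and labels bound by `ν`; nobody moves at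
literals. -/
def turn [DecidableEq Λ] (φ₀ : Formula Φ Λ) (p : GPos W) : Option Player :=
  match nodeAt φ₀ p.addr with
  | some (.or _ _) => some .eloise
  | some (.and _ _) => some .abelard
  | some (.dia _) => some .eloise
  | some (.box _) => some .abelard
  | some (.mu _ _) => some .eloise
  | some (.nu _ _) => some .abelard
  | some (.label X) =>
      match (refOcc φ₀ X p.addr).bind (nodeAt φ₀) with
      | some (.mu _ _) => some .eloise
      | some (.nu _ _) => some .abelard
      | _ => none
  | _ => none

/-- The clock mapping after a move at a label occurrence whose reference formula sits at
address `r`: the clock of `r` becomes `γ'`, clocks of all μν-subformula occurrences of the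
body of the reference formula are reset to `Γ`, all other clocks are unchanged. -/
def clockReset (Γ γ' : Ordinal) (r : List ℕ) (c : List ℕ → Ordinal) : List ℕ → Ordinal :=
  fun o => if o = r then γ' else if (r ++ [0]).isPrefixOf o then Γ else c o

/-- The set of positions reachable from `p` in one round of the Γ-bounded evaluation game
for `φ₀` on `M`, according to the rules of the game. -/
def moves [DecidableEq Λ] (M : Kripke Φ W) (φ₀ : Formula Φ Λ) (Γ : Ordinal)
    (p : GPos W) : Set (GPos W) :=
  match nodeAt φ₀ p.addr with
  | some (.or _ _) => {⟨p.world, p.addr ++ [0], p.clock⟩, ⟨p.world, p.addr ++ [1], p.clock⟩}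
  | some (.and _ _) => {⟨p.world, p.addr ++ [0], p.clock⟩, ⟨p.world, p.addr ++ [1], p.clock⟩}
  | some (.dia _) => {q | ∃ v, M.R p.world v ∧ q = ⟨v, p.addr ++ [0], p.clock⟩}
  | some (.box _) => {q | ∃ v, M.R p.world v ∧ q = ⟨v, p.addr ++ [0], p.clock⟩}
  | some (.mu _ _) =>
      {q | ∃ γ < Γ, q = ⟨p.world, p.addr ++ [0], Function.update p.clock p.addr γ⟩}
  | some (.nu _ _) =>
      {q | ∃ γ < Γ, q = ⟨p.world, p.addr ++ [0], Function.update p.clock p.addr γ⟩}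
  | some (.label X) =>
      match refOcc φ₀ X p.addr with
      | some r => {q | ∃ γ' < p.clock r, q = ⟨p.world, r ++ [0], clockReset Γ γ' r p.clock⟩}
      | none => ∅
  | _ => ∅

/-- The winner of the game at an ending position: at `(w,p,c)` Eloise wins iff `w ∈ V(p)`,
at `(w,¬p,c)` iff `w ∉ V(p)`; at any other position with no available moves, the player
who should move loses (so Abelard wins at `◇` with no successor and at labels bound by `μ`
with clock value `0`, and dually for Eloise). -/
noncomputable def winsTerminal [DecidableEq Λ] (M : Kripke Φ W) (φ₀ : Formula Φ Λ)
    (p : GPos W) : Player :=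
  match nodeAt φ₀ p.addr with
  | some (.atom q) => if p.world ∈ M.V q then .eloise else .abelard
  | some (.natom q) => if p.world ∈ M.V q then .abelard else .eloise
  | _ =>
      match turn φ₀ p with
      | some .eloise => .abelard
      | _ => .eloise

/-- The initial position `(w₀, φ₀, c₀)` of the game, where `c₀` is constantly `Γ`. -/
def initPos (w₀ : W) (Γ : Ordinal) : GPos W := ⟨w₀, [], fun _ => Γ⟩

/-- `ConsPlay M φ₀ Γ w₀ P σ f` : the finite sequence of positions `f` is a (partial) play of
the Γ-bounded evaluation game `(M, w₀, φ₀, Γ)` in which player `P` follows the positional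
strategy `σ`: it starts at the initial position, every step obeys the rules of the game,
and at every position where `P` moves, the move is the one prescribed by `σ`. -/
def ConsPlay [DecidableEq Λ] (M : Kripke Φ W) (φ₀ : Formula Φ Λ) (Γ : Ordinal) (w₀ : W)
    (P : Player) (σ : GPos W → GPos W) (f : List (GPos W)) : Prop :=
  f.head? = some (initPos w₀ Γ) ∧
    ∀ i, (h : i + 1 < f.length) →
      f[i + 1] ∈ moves M φ₀ Γ (f[i]'(Nat.lt_of_succ_lt h)) ∧
        (turn φ₀ (f[i]'(Nat.lt_of_succ_lt h)) = some P →
          f[i + 1] = σ (f[i]'(Nat.lt_of_succ_lt h)))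

/-- `WinStrat M φ₀ Γ w₀ P σ` : the (positional) strategy `σ` is a winning strategy for
player `P` in the Γ-bounded evaluation game `(M, w₀, φ₀, Γ)`: along any play in which `P`
follows `σ`, whenever it is `P`'s turn and some move is available, `σ` prescribes a legal
move (so `P` can always continue playing according to `σ`), and every ending position ever
reached is winning for `P`. -/
noncomputable def WinStrat [DecidableEq Λ] (M : Kripke Φ W) (φ₀ : Formula Φ Λ)
    (Γ : Ordinal) (w₀ : W) (P : Player) (σ : GPos W → GPos W) : Prop :=
  ∀ f, ConsPlay M φ₀ Γ w₀ P σ f → ∀ p, f.getLast? = some p →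
    (turn φ₀ p = some P → (moves M φ₀ Γ p).Nonempty → σ p ∈ moves M φ₀ Γ p) ∧
      (moves M φ₀ Γ p = ∅ → winsTerminal M φ₀ p = P)

/-- The height of the syntax tree of a formula. -/
def Formula.height : Formula Φ Λ → ℕ
  | .atom _ => 0
  | .natom _ => 0
  | .label _ => 0
  | .or φ ψ => max φ.height ψ.height + 1
  | .and φ ψ => max φ.height ψ.height + 1
  | .dia φ => φ.height + 1
  | .box φ => φ.height + 1
  | .mu _ φ => φ.height + 1
  | .nu _ φ => φ.height + 1

theorem length_le_height_of_nodeAt {φ ψ : Formula Φ Λ} {o : List ℕ}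
    (h : nodeAt φ o = some ψ) : o.length ≤ φ.height := by
  fun_induction nodeAt φ o <;> simp_all [Formula.height]

theorem prefix_of_refOcc [DecidableEq Λ] {φ₀ : Formula Φ Λ} {X : Λ} {o r : List ℕ}
    (h : refOcc φ₀ X o = some r) : r <+: o := by
  have := List.mem_of_getLast? h
  simpa using (List.mem_filter.1 this).1

/-- The move from `p` to `q` descends to a child in the syntax tree, changing at most the clock
of the occurrence at `p`. -/
def IsDescent (p q : GPos W) : Prop :=
  (∃ i, q.addr = p.addr ++ [i]) ∧ ∀ o ≠ p.addr, q.clock o = p.clock o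

/-- The move from `p` to `q` jumps from a label occurrence to the body of the formula at
address `r`. -/
def IsJump (Γ : Ordinal) (r : List ℕ) (p q : GPos W) : Prop :=
  r <+: p.addr ∧ q.addr = r ++ [0] ∧ ∃ γ < p.clock r, q.clock = clockReset Γ γ r p.clock

theorem isDescent_or_isJump_of_mem_moves [DecidableEq Λ] {M : Kripke Φ W} {φ₀ : Formula Φ Λ}
    {Γ : Ordinal} {p q : GPos W} (h : q ∈ moves M φ₀ Γ p) :
    IsDescent p q ∨ ∃ r, IsJump Γ r p q := by
  unfold moves at h
  split at h
  · rcases h with rfl | rfl <;> exact .inl ⟨⟨_, rfl⟩, fun _ _ => rfl⟩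
  · rcases h with rfl | rfl <;> exact .inl ⟨⟨_, rfl⟩, fun _ _ => rfl⟩
  · obtain ⟨v, -, rfl⟩ := h
    exact .inl ⟨⟨_, rfl⟩, fun _ _ => rfl⟩
  · obtain ⟨v, -, rfl⟩ := h
    exact .inl ⟨⟨_, rfl⟩, fun _ _ => rfl⟩
  · obtain ⟨γ, -, rfl⟩ := h
    exact .inl ⟨⟨_, rfl⟩, fun _ ho => Function.update_of_ne ho _ _⟩
  · obtain ⟨γ, -, rfl⟩ := h
    exact .inl ⟨⟨_, rfl⟩, fun _ ho => Function.update_of_ne ho _ _⟩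
  · split at h
    · rename_i r hr
      obtain ⟨γ, hγ, rfl⟩ := h
      exact .inr ⟨r, prefix_of_refOcc hr, rfl, γ, hγ, rfl⟩
    · exact h.elim
  · exact h.elim

theorem length_addr_le_height_of_mem_moves [DecidableEq Λ] {M : Kripke Φ W}
    {φ₀ : Formula Φ Λ} {Γ : Ordinal} {p q : GPos W} (h : q ∈ moves M φ₀ Γ p) :
    p.addr.length ≤ φ₀.height := by
  cases hn : nodeAt φ₀ p.addr with
  | none => simp [moves, hn] at h
  | some ψ => exact length_le_height_of_nodeAt hn

theorem IsJump.clock_lt {Γ : Ordinal} {r : List ℕ} {p q : GPos W} (h : IsJump Γ r p q) :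
    q.clock r < p.clock r := by
  obtain ⟨-, -, γ, hγ, hc⟩ := h
  simpa [hc, clockReset] using hγ

theorem IsJump.clock_eq {Γ : Ordinal} {r s : List ℕ} {p q : GPos W} (h : IsJump Γ s p q)
    (hlt : r.length < s.length) : q.clock r = p.clock r := by
  obtain ⟨-, -, γ, -, hc⟩ := h
  have hne : r ≠ s := by rintro rfl; exact hlt.false
  have hpre : ¬ (s ++ [0]) <+: r := fun hp => by
    have := hp.length_le
    simp at this
    omega
  rw [hc, clockReset, if_neg hne, if_neg (by simpa using hpre)]

/-- Below an occurrence `r`, a jump to an occurrence at least as deep as `r` either goes to `r`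
or to an occurrence strictly below it. -/
theorem IsJump.eq_or_prefix {Γ : Ordinal} {r s : List ℕ} {p q : GPos W} (h : IsJump Γ s p q)
    (hr : r ++ [0] <+: p.addr) (hle : r.length ≤ s.length) :
    s = r ∨ r.length < s.length ∧ r ++ [0] <+: s := by
  rcases hle.eq_or_lt with he | hlt
  · have hr' : r <+: p.addr := (List.prefix_append r [0]).trans hr
    exact .inl ((List.prefix_of_prefix_length_le hr' h.1 hle).eq_of_length he).symm
  · exact .inr ⟨hlt, List.prefix_of_prefix_length_le hr h.1 (by simpa using hlt)⟩

theorem step_below {Γ : Ordinal} {r : List ℕ} {p q : GPos W}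
    (hpq : IsDescent p q ∨ ∃ s, IsJump Γ s p q) (hr : r ++ [0] <+: p.addr)
    (hle : ∀ s, IsJump Γ s p q → r.length ≤ s.length) :
    r ++ [0] <+: q.addr ∧ q.clock r ≤ p.clock r := by
  rcases hpq with ⟨⟨i, hi⟩, hc⟩ | ⟨s, hs⟩
  · refine ⟨hi ▸ hr.trans (List.prefix_append _ _), (hc r ?_).le⟩
    rintro rfl
    simpa using hr.length_le
  · rcases hs.eq_or_prefix hr (hle s hs) with rfl | ⟨hlt, hp⟩
    · exact ⟨hs.2.1 ▸ List.prefix_rfl, hs.clock_lt.le⟩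
    · exact ⟨hs.2.1 ▸ hp.trans (List.prefix_append _ _), (hs.clock_eq hlt).le⟩

open Filter in
/-- An antitone sequence in a well-founded order cannot decrease strictly infinitely often. -/
theorem not_frequently_succ_lt_of_antitone {α : Type*} [PartialOrder α] [WellFoundedLT α]
    {u : ℕ → α} (hu : Antitone u) : ¬ ∃ᶠ n in atTop, u (n + 1) < u n := by
  intro h
  obtain ⟨_, ⟨m, rfl⟩, hm⟩ := wellFounded_lt.has_min (Set.range u) (Set.range_nonempty u)
  obtain ⟨n, hn, hlt⟩ := frequently_atTop.1 h m
  exact hm _ ⟨n + 1, rfl⟩ (hlt.trans_le (hu hn))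

open Filter in
/-- A sequence of descents and jumps along addresses of bounded length jumps infinitely often. -/
theorem frequently_isJump {Γ : Ordinal} {D : ℕ} {f : ℕ → GPos W}
    (hf : ∀ n, IsDescent (f n) (f (n + 1)) ∨ ∃ r, IsJump Γ r (f n) (f (n + 1)))
    (hD : ∀ n, (f n).addr.length ≤ D) :
    ∃ᶠ n in atTop, ∃ r, IsJump Γ r (f n) (f (n + 1)) := by
  intro h
  obtain ⟨N, hN⟩ := eventually_atTop.1 h
  have key : ∀ m, m ≤ (f (N + m)).addr.length := by
    intro m
    induction m with
    | zero => exact Nat.zero_le _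
    | succ m ih =>
      obtain ⟨⟨i, hi⟩, -⟩ := (hf (N + m)).resolve_right (hN _ (Nat.le_add_right _ _))
      rw [← Nat.add_assoc, hi]
      simpa using ih
  exact absurd (key (D + 1)) (by have := hD (N + (D + 1)); omega)

/-- Every play of a Γ-bounded evaluation game `G = (M, w₀, φ₀, Γ)` ends after
finitely many rounds: there is no infinite sequence of positions starting at the initial
position of `G` in which each next position is reachable from the previous one in one round
of `G`. -/
theorem no_infinite_play [DecidableEq Λ] [Nonempty W] (M : Kripke Φ W) (w₀ : W)
    (φ₀ : Formula Φ Λ) (hφ : IsSentence φ₀) (Γ : Ordinal) :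
    ¬ ∃ f : ℕ → GPos W, f 0 = initPos w₀ Γ ∧ ∀ n, f (n + 1) ∈ moves M φ₀ Γ (f n) := by
  rintro ⟨f, -, hf⟩
  have hstep n := isDescent_or_isJump_of_mem_moves (hf n)
  have hD n := length_addr_le_height_of_mem_moves (hf n)
  let P (k : ℕ) : Prop := ∃ᶠ n in Filter.atTop,
    ∃ r, r.length ≤ k ∧ IsJump Γ r (f n) (f (n + 1))
  have hP : ∃ k, P k := ⟨φ₀.height, (frequently_isJump hstep hD).mono
    fun n ⟨r, hr⟩ => ⟨r, hr.1.length_le.trans (hD n), hr⟩⟩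
  obtain ⟨k, hk, hmin⟩ : ∃ k, P k ∧ ∀ j < k, ¬ P j :=
    ⟨Nat.find hP, Nat.find_spec hP, fun _ => Nat.find_min hP⟩
  obtain ⟨N, hN⟩ : ∃ N, ∀ n ≥ N, ∀ s, IsJump Γ s (f n) (f (n + 1)) → k ≤ s.length := by
    rcases k with - | k
    · exact ⟨0, fun _ _ _ _ => Nat.zero_le _⟩
    · obtain ⟨N, hN⟩ := Filter.eventually_atTop.1
        (Filter.not_frequently.1 (hmin k k.lt_succ_self))
      exact ⟨N, fun n hn s hs => not_le.1 fun hle => hN n hn ⟨s, hle, hs⟩⟩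
  obtain ⟨n₀, hn₀, r, hrk, hr⟩ := Filter.frequently_atTop.1 hk N
  obtain rfl : r.length = k := hrk.antisymm (hN n₀ hn₀ r hr)
  have hbelow : ∀ m, r ++ [0] <+: (f (n₀ + 1 + m)).addr := by
    intro m
    induction m with
    | zero => exact hr.2.1 ▸ List.prefix_rfl
    | succ m ih => exact (step_below (hstep _) ih (hN _ (by omega))).1
  have hanti : Antitone fun m => (f (n₀ + 1 + m)).clock r :=
    antitone_nat_of_succ_le fun m => (step_below (hstep _) (hbelow m) (hN _ (by omega))).2
  refine not_frequently_succ_lt_of_antitone hanti (Filter.frequently_atTop.2 fun a => ?_)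
  obtain ⟨n, hn, s, hsk, hs⟩ := Filter.frequently_atTop.1 hk (n₀ + 1 + a)
  obtain ⟨m, rfl⟩ := Nat.exists_eq_add_of_le (show n₀ + 1 ≤ n by omega)
  obtain rfl : s = r := (hs.eq_or_prefix (hbelow m) (hN _ (by omega) s hs)).resolve_right
    fun h => hsk.not_gt h.1
  exact ⟨m, by omega, hs.clock_lt⟩
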